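/- arXiv:1904.01072 — 4 statements merged into one kernel-verified Lean document; each statement's English description precedes it below -/
import Mathlib

section
/- For every unitary 2×2 complex matrix U there exist real numbers α, β, γ and δ such that U = e^{iα} · Rz(β) · Ry(γ) · Rz(δ). -/
open Matrix

/-- The single-qubit rotation gate `Ry(θ)`. -/
noncomputable def Ry (θ : ℝ) : Matrix (Fin 2) (Fin 2) ℂ :=
  !![Real.cos (θ / 2), Real.sin (θ / 2);
     -Real.sin (θ / 2), Real.cos (θ / 2)]

/-- The single-qubit rotation gate `Rz(θ)`. -/
noncomputable def Rz (θ : ℝ) : Matrix (Fin 2) (Fin 2) ℂ :=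
  !![Complex.exp (Complex.I * (θ / 2)), 0;
     0, Complex.exp (-(Complex.I * (θ / 2)))]

theorem exp_smul_Rz_mul_Ry_mul_Rz (α β γ δ : ℝ) :
    Complex.exp (Complex.I * α) • (Rz β * Ry γ * Rz δ) =
      !![Real.cos (γ / 2) * Complex.exp (Complex.I * (α + (β + δ) / 2)),
          Real.sin (γ / 2) * Complex.exp (Complex.I * (α + (β - δ) / 2));
        -(Real.sin (γ / 2) * Complex.exp (Complex.I * (α - (β - δ) / 2))),
          Real.cos (γ / 2) * Complex.exp (Complex.I * (α - (β + δ) / 2))] := by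
  have hexp (x y z r : ℂ) : Complex.exp x * (Complex.exp y * r * Complex.exp z) =
      r * Complex.exp (x + y + z) := by
    rw [Complex.exp_add, Complex.exp_add]
    ring
  rw [Rz, Ry, Rz, mul_fin_two, mul_fin_two]
  simp only [smul_of, smul_cons, smul_empty, smul_eq_mul, zero_mul, mul_zero, add_zero, zero_add,
    hexp, neg_mul]
  ring_nf

/-- A unitary `2 × 2` matrix is determined by its first row and its determinant. -/
theorem unitary_second_row_eq (U : Matrix (Fin 2) (Fin 2) ℂ) (hU : Uᴴ * U = 1) :
    U 1 0 = -(U.det * star (U 0 1)) ∧ U 1 1 = U.det * star (U 0 0) := by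
  have hU' : U * Uᴴ = 1 := mul_eq_one_comm.mp hU
  have h₀ := congrFun₂ hU' 0 0
  have h₁ := congrFun₂ hU' 1 0
  simp only [mul_apply, Fin.sum_univ_two, conjTranspose_apply, one_apply_eq, ne_eq, one_ne_zero,
    not_false_eq_true, one_apply_ne] at h₀ h₁
  rw [det_fin_two]
  constructor
  · linear_combination U 0 0 * h₁ - U 1 0 * h₀
  · linear_combination U 0 1 * h₁ - U 1 1 * h₀

theorem norm_det_eq_one_of_unitary (U : Matrix (Fin 2) (Fin 2) ℂ) (hU : Uᴴ * U = 1) :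
    ‖U.det‖ = 1 := by
  have h := congrArg det hU
  rw [det_mul, det_conjTranspose, det_one] at h
  exact CStarRing.norm_of_mem_unitary
    (Unitary.mem_iff.mpr ⟨h, by rw [mul_comm]; exact h⟩)

theorem norm_sq_first_row_of_unitary (U : Matrix (Fin 2) (Fin 2) ℂ) (hU : Uᴴ * U = 1) :
    ‖U 0 0‖ ^ 2 + ‖U 0 1‖ ^ 2 = 1 := by
  have h := congrFun₂ (mul_eq_one_comm.mp hU : U * Uᴴ = 1) 0 0
  simp only [mul_apply, Fin.sum_univ_two, conjTranspose_apply, one_apply_eq,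
    RCLike.star_def, Complex.mul_conj'] at h
  exact_mod_cast h

/-- ZYZ decomposition: every 2×2 unitary `U` can be written as
`e^{iα} · Rz(β) · Ry(γ) · Rz(δ)`. -/
theorem zyz_decomposition (U : Matrix (Fin 2) (Fin 2) ℂ) (hU : Uᴴ * U = 1) :
    ∃ α β γ δ : ℝ, U = Complex.exp (Complex.I * α) • (Rz β * Ry γ * Rz δ) := by
  obtain ⟨hc, hd⟩ := unitary_second_row_eq U hU
  have hrow := norm_sq_first_row_of_unitary U hU
  have hdet : Complex.exp (U.det.arg * Complex.I) = U.det := by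
    simpa [norm_det_eq_one_of_unitary U hU] using Complex.norm_mul_exp_arg_mul_I U.det
  have ha := Complex.norm_mul_exp_arg_mul_I (U 0 0)
  have hb := Complex.norm_mul_exp_arg_mul_I (U 0 1)
  set p := (U 0 0).arg
  set q := (U 0 1).arg
  set t := U.det.arg
  have hcos : Real.cos (Real.arccos ‖U 0 0‖) = ‖U 0 0‖ :=
    Real.cos_arccos (by linarith [norm_nonneg (U 0 0)])
      (by nlinarith [norm_nonneg (U 0 0), sq_nonneg ‖U 0 1‖])
  have hsin : Real.sin (Real.arccos ‖U 0 0‖) = ‖U 0 1‖ := by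
    rw [Real.sin_arccos, show 1 - ‖U 0 0‖ ^ 2 = ‖U 0 1‖ ^ 2 by linarith,
      Real.sqrt_sq (norm_nonneg _)]
  have hconj (x : ℝ) : star (Complex.exp (x * Complex.I)) = Complex.exp (-(x * Complex.I)) := by
    rw [RCLike.star_def, ← Complex.exp_conj]
    simp
  rw [← hdet, ← hb, star_mul', hconj, RCLike.star_def, Complex.conj_ofReal,
    mul_left_comm, ← Complex.exp_add] at hc
  rw [← hdet, ← ha, star_mul', hconj, RCLike.star_def, Complex.conj_ofReal,
    mul_left_comm, ← Complex.exp_add] at hd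
  refine ⟨t / 2, p + q - t, 2 * Real.arccos ‖U 0 0‖, p - q, ?_⟩
  rw [exp_smul_Rz_mul_Ry_mul_Rz, mul_div_cancel_left₀ _ (two_ne_zero' ℝ), hcos, hsin]
  refine (eta_fin_two U).trans ?_
  congr! 4
  · refine ha.symm.trans ?_
    congr 2
    push_cast
    ring
  · refine hb.symm.trans ?_
    congr 2
    push_cast
    ring
  · rw [hc]
    congr 3
    push_cast
    ring
  · rw [hd]
    congr 3
    push_cast
    ring
end

section
/- For every unitary 2×2 complex matrix U there exist real numbers α, β, γ and δ such that U = e^{iα} · Rx(β) · Ry(γ) · Rx(δ). -/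
open Matrix

/-- The single-qubit rotation gate `Rx(θ)`. -/
noncomputable def Rx (θ : ℝ) : Matrix (Fin 2) (Fin 2) ℂ :=
  !![Real.cos (θ / 2), Complex.I * Real.sin (θ / 2);
     Complex.I * Real.sin (θ / 2), Real.cos (θ / 2)]

theorem exists_polar_coord (a b : ℝ) :
    ∃ r θ : ℝ, 0 ≤ r ∧ r ^ 2 = a ^ 2 + b ^ 2 ∧ a = r * Real.cos θ ∧ b = r * Real.sin θ := by
  refine ⟨‖(⟨a, b⟩ : ℂ)‖, Complex.arg ⟨a, b⟩, norm_nonneg _, ?_, ?_, ?_⟩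
  · rw [Complex.sq_norm, Complex.normSq_mk]; ring
  · exact (Complex.norm_mul_cos_arg ⟨a, b⟩).symm
  · exact (Complex.norm_mul_sin_arg ⟨a, b⟩).symm

theorem Rx_mul_Ry_mul_Rx (p q c : ℝ) :
    Rx (p + q) * Ry (2 * c) * Rx (p - q) =
      !![⟨Real.cos c * Real.cos p, -(Real.sin c * Real.sin q)⟩,
         ⟨Real.sin c * Real.cos q, Real.cos c * Real.sin p⟩;
         ⟨-(Real.sin c * Real.cos q), Real.cos c * Real.sin p⟩,
         ⟨Real.cos c * Real.cos p, Real.sin c * Real.sin q⟩] := by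
  have hp : p = (p + q) / 2 + (p - q) / 2 := by ring
  have hq : q = (p + q) / 2 - (p - q) / 2 := by ring
  have hc : 2 * c / 2 = c := by ring
  have hcp := congrArg Real.cos hp
  have hsp := congrArg Real.sin hp
  have hcq := congrArg Real.cos hq
  have hsq := congrArg Real.sin hq
  rw [Real.cos_add] at hcp
  rw [Real.sin_add] at hsp
  rw [Real.cos_sub] at hcq
  rw [Real.sin_sub] at hsq
  rw [hcp, hsp, hcq, hsq, Rx, Ry, Rx, hc]
  ext i j
  fin_cases i <;> fin_cases j <;> apply Complex.ext <;>
    simp [Matrix.mul_apply, Fin.sum_univ_two, -Complex.ofReal_cos, -Complex.ofReal_sin] <;> ring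

/-- Every element of `SU(2)` is a product `Rx(β) · Ry(γ) · Rx(δ)`. -/
theorem exists_eq_Rx_mul_Ry_mul_Rx (V : Matrix (Fin 2) (Fin 2) ℂ) (hV : Vᴴ * V = 1)
    (hdet : V.det = 1) : ∃ β γ δ : ℝ, V = Rx β * Ry γ * Rx δ := by
  have hadj : Vᴴ = V.adjugate := by
    calc Vᴴ = Vᴴ * (V * V.adjugate) := by rw [Matrix.mul_adjugate, hdet, one_smul, mul_one]
      _ = V.adjugate := by rw [← mul_assoc, hV, one_mul]
  rw [Matrix.adjugate_fin_two] at hadj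
  have h00 : star (V 0 0) = V 1 1 := by simpa using congrFun₂ hadj 0 0
  have h01 : star (V 0 1) = -V 1 0 := by simpa using congrFun₂ hadj 1 0
  rw [Matrix.det_fin_two] at hdet
  obtain ⟨r, p, -, hr2, hx, hw⟩ := exists_polar_coord (V 0 0).re (V 0 1).im
  obtain ⟨s, q, -, hs2, hz, hy⟩ := exists_polar_coord (V 0 1).re (-(V 0 0).im)
  have h10 : V 1 0 = -star (V 0 1) := by rw [h01, neg_neg]
  have hrs : r ^ 2 + s ^ 2 = 1 := by
    have h := congrArg Complex.re hdet
    rw [← h00, h10] at h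
    simp at h
    linarith
  obtain ⟨t, c, ht, ht2, hrc, hsc⟩ := exists_polar_coord r s
  have ht1 : t = 1 := by nlinarith
  rw [ht1, one_mul] at hrc hsc
  refine ⟨p + q, 2 * c, p - q, ?_⟩
  rw [Rx_mul_Ry_mul_Rx, ← hrc, ← hsc, ← hx, ← hw, ← hz, ← hy]
  ext i j
  fin_cases i <;> fin_cases j <;> apply Complex.ext <;> simp [h10, ← h00]

/-- XYX decomposition: every 2×2 unitary `U` can be written as
`e^{iα} · Rx(β) · Ry(γ) · Rx(δ)`. -/
theorem xyx_decomposition (U : Matrix (Fin 2) (Fin 2) ℂ) (hU : Uᴴ * U = 1) :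
    ∃ α β γ δ : ℝ, U = Complex.exp (Complex.I * α) • (Rx β * Ry γ * Rx δ) := by
  have hnorm : ‖U.det‖ = 1 := by
    have h := congrArg Matrix.det hU
    rw [Matrix.det_mul, Matrix.det_conjTranspose, Matrix.det_one] at h
    have h2 := congrArg norm h
    rw [norm_mul, norm_star, norm_one] at h2
    nlinarith [norm_nonneg U.det]
  set α : ℝ := U.det.arg / 2 with hα
  have hsq : U.det = Complex.exp (Complex.I * α) ^ 2 := by
    rw [← Complex.exp_nat_mul, ← Complex.norm_mul_exp_arg_mul_I U.det, hnorm, hα]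
    push_cast
    rw [one_mul]
    congr 1
    ring
  set e := Complex.exp (Complex.I * α) with he
  have he0 : e ≠ 0 := Complex.exp_ne_zero _
  have hee : star e⁻¹ * e⁻¹ = 1 := by
    have h : ‖e⁻¹‖ = 1 := by rw [norm_inv, he, mul_comm, Complex.norm_exp_ofReal_mul_I, inv_one]
    simpa [h] using Complex.conj_mul' e⁻¹
  obtain ⟨β, γ, δ, h⟩ := exists_eq_Rx_mul_Ry_mul_Rx (e⁻¹ • U)
    (by rw [Matrix.conjTranspose_smul, smul_mul_smul_comm, hee, hU, one_smul])
    (by rw [Matrix.det_smul, hsq, Fintype.card_fin, ← mul_pow, inv_mul_cancel₀ he0, one_pow])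
  exact ⟨α, β, γ, δ, by rw [← h, smul_inv_smul₀ he0]⟩
end

section
/- (R–Rx decomposition) For every unitary 2×2 complex matrix U there exist real numbers α, θ, φ and δ such that U = e^{iα} · R(θ, φ) · Rx(δ). -/
open Matrix

/-- The trapped-ion single-qubit gate `R(θ, φ)`. -/
noncomputable def Rgate (θ φ : ℝ) : Matrix (Fin 2) (Fin 2) ℂ :=
  !![Real.cos (θ / 2), -Complex.I * Complex.exp (-(Complex.I * φ)) * Real.sin (θ / 2);
     -Complex.I * Complex.exp (Complex.I * φ) * Real.sin (θ / 2), Real.cos (θ / 2)]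

/-- A special unitary matrix with real diagonal is a trapped-ion gate. -/
lemma exists_Rgate_eq (x : ℝ) (q : ℂ) (h : x ^ 2 + ‖q‖ ^ 2 = 1) :
    ∃ θ φ : ℝ, Rgate θ φ = !![(x : ℂ), -star q; q, (x : ℂ)] := by
  set w : ℂ := ⟨x, ‖q‖⟩ with hw
  have hn : ‖w‖ = 1 := by
    rw [← sq_eq_sq₀ (norm_nonneg _) zero_le_one, Complex.sq_norm, Complex.normSq_apply, hw]
    linarith
  have hc : Real.cos w.arg = x := by simpa [hn] using Complex.norm_mul_cos_arg w
  have hs : Real.sin w.arg = ‖q‖ := by simpa [hn] using Complex.norm_mul_sin_arg w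
  have hq : -Complex.I * Complex.exp (Complex.I * (q.arg + Real.pi / 2 : ℝ)) * ‖q‖ = q := by
    have : Complex.I * (q.arg + Real.pi / 2 : ℝ) =
        q.arg * Complex.I + Real.pi / 2 * Complex.I := by push_cast; ring
    rw [this, Complex.exp_add, Complex.exp_pi_div_two_mul_I]
    linear_combination Complex.norm_mul_exp_arg_mul_I q -
      Complex.exp (q.arg * Complex.I) * ‖q‖ * Complex.I_sq
  have hq' : -Complex.I * Complex.exp (-(Complex.I * (q.arg + Real.pi / 2 : ℝ))) * ‖q‖ =
      -star q := by
    have := congrArg star hq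
    simp only [Complex.star_def, map_mul, map_neg, ← Complex.exp_conj, Complex.conj_I,
      Complex.conj_ofReal] at this ⊢
    rw [← this, neg_mul Complex.I (Complex.ofReal _)]
    ring
  refine ⟨2 * w.arg, q.arg + Real.pi / 2, ?_⟩
  rw [Rgate, mul_div_cancel_left₀ _ two_ne_zero, hc, hs, hq, hq']

/-- The R–Rx decomposition of a special unitary matrix. -/
lemma exists_Rgate_mul_Rx_eq (p q : ℂ) (h : ‖p‖ ^ 2 + ‖q‖ ^ 2 = 1) :
    ∃ θ φ δ : ℝ, Rgate θ φ * Rx δ = !![p, -star q; q, star p] := by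
  set z : ℂ := ⟨q.re, -p.im⟩ with hz
  have hc : ‖z‖ * Real.cos z.arg = q.re := Complex.norm_mul_cos_arg z
  have hs : ‖z‖ * Real.sin z.arg = -p.im := Complex.norm_mul_sin_arg z
  set t := z.arg
  have h1 := Real.sin_sq_add_cos_sq t
  rw [Complex.sq_norm, Complex.sq_norm, Complex.normSq_apply, Complex.normSq_apply] at h
  have him : p.im * Real.cos t + q.re * Real.sin t = 0 := by
    linear_combination (-Real.sin t) * hc + Real.cos t * hs
  obtain ⟨θ, φ, hR⟩ := exists_Rgate_eq (p.re * Real.cos t + q.im * Real.sin t)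
    (q * Real.cos t - Complex.I * Real.sin t * star p) (by
      rw [Complex.sq_norm, Complex.normSq_apply]
      simp [-Complex.ofReal_cos, -Complex.ofReal_sin]
      linear_combination h + (p.re^2 + p.im^2 + q.re^2 + q.im^2) * h1
        - (p.im * Real.cos t + q.re * Real.sin t) * him)
  refine ⟨θ, φ, 2 * t, ?_⟩
  rw [hR, Rx, mul_div_cancel_left₀ _ two_ne_zero]
  ext i j
  fin_cases i <;> fin_cases j <;> apply Complex.ext <;>
    simp [-Complex.ofReal_cos, -Complex.ofReal_sin, Matrix.mul_apply, Fin.sum_univ_two]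
  · linear_combination p.re * h1
  · linear_combination p.im * h1 - Real.cos t * him
  · linear_combination -q.re * h1 + Real.sin t * him
  · linear_combination q.im * h1
  · linear_combination q.re * h1 - Real.sin t * him
  · linear_combination q.im * h1
  · linear_combination p.re * h1
  · linear_combination -p.im * h1 + Real.cos t * him

/-- The first column of a special unitary matrix determines the matrix. -/
lemma exists_eq_of_conjTranspose_mul_self_of_det_eq_one (V : Matrix (Fin 2) (Fin 2) ℂ)
    (hV : Vᴴ * V = 1) (hdet : V.det = 1) :
    ∃ p q : ℂ, ‖p‖ ^ 2 + ‖q‖ ^ 2 = 1 ∧ V = !![p, -star q; q, star p] := by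
  have hadj : V.adjugate = Vᴴ := by
    calc V.adjugate = Vᴴ * V * V.adjugate := by rw [hV, one_mul]
      _ = Vᴴ := by rw [mul_assoc, mul_adjugate, hdet, one_smul, mul_one]
  rw [adjugate_fin_two] at hadj
  have h00 : V 1 1 = star (V 0 0) := by simpa using congrFun₂ hadj 0 0
  have h01 : -V 0 1 = star (V 1 0) := by simpa using congrFun₂ hadj 0 1
  refine ⟨V 0 0, V 1 0, ?_, ?_⟩
  · have h := congrFun₂ hV 0 0
    simp only [mul_apply, Fin.sum_univ_two, conjTranspose_apply, one_apply_eq, Complex.star_def,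
      Complex.conj_mul'] at h
    exact_mod_cast h
  · rw [← h00, ← h01, neg_neg]
    exact eta_fin_two V

/-- R–Rx decomposition: every 2×2 unitary `U` can be written as
`e^{iα} · R(θ, φ) · Rx(δ)`. -/
theorem R_Rx_decomposition (U : Matrix (Fin 2) (Fin 2) ℂ) (hU : Uᴴ * U = 1) :
    ∃ α θ φ δ : ℝ, U = Complex.exp (Complex.I * α) • (Rgate θ φ * Rx δ) := by
  have hdet : ‖U.det‖ = 1 := by
    have h := congrArg det hU
    rw [det_mul, det_conjTranspose, det_one, Complex.star_def, Complex.conj_mul'] at h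
    exact (pow_eq_one_iff_of_nonneg (norm_nonneg _) two_ne_zero).mp (by exact_mod_cast h)
  set α : ℝ := U.det.arg / 2
  set e := Complex.exp (-(Complex.I * α)) with he
  have hα : Complex.exp (Complex.I * α) * e = 1 := by
    rw [he, ← Complex.exp_add, add_neg_cancel, Complex.exp_zero]
  have hstar : star e = Complex.exp (Complex.I * α) := by
    simp [he, ← Complex.exp_conj]
  have hU' : U.det = Complex.exp (Complex.I * α) ^ 2 := by
    rw [← Complex.norm_mul_exp_arg_mul_I U.det, hdet, ← Complex.exp_nat_mul]
    simp only [α]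
    push_cast
    ring_nf
  obtain ⟨p, q, hpq, hV⟩ := exists_eq_of_conjTranspose_mul_self_of_det_eq_one (e • U)
    (by rw [conjTranspose_smul, smul_mul_smul_comm, hU, hstar, hα, one_smul])
    (by rw [det_smul, Fintype.card_fin, hU', ← mul_pow, mul_comm, hα, one_pow])
  obtain ⟨θ, φ, δ, h⟩ := exists_Rgate_mul_Rx_eq p q hpq
  exact ⟨α, θ, φ, δ, by rw [h, ← hV, smul_smul, hα, one_smul]⟩
end

section
/- Let N and M be positive integers and let X and Y be N×M complex matrices such that X†X = Y†Y. Then there exists an N×N unitary complex matrix U such that U·X = Y. -/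
open Matrix

theorem LinearMap.exists_linearIsometry_comp_eq {𝕜 E V : Type*} [RCLike 𝕜]
    [AddCommGroup E] [Module 𝕜 E]
    [NormedAddCommGroup V] [InnerProductSpace 𝕜 V] [FiniteDimensional 𝕜 V]
    (f g : E →ₗ[𝕜] V) (hfg : ∀ x, ‖f x‖ = ‖g x‖) :
    ∃ L : V →ₗᵢ[𝕜] V, ∀ x, L (f x) = g x := by
  obtain ⟨s, hs⟩ := f.rangeRestrict.exists_rightInverse_of_surjective f.range_rangeRestrict
  have hs' (y : LinearMap.range f) : f (s y) = y :=
    congrArg Subtype.val (LinearMap.congr_fun hs y)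
  let L₀ : LinearMap.range f →ₗᵢ[𝕜] V :=
    { toLinearMap := g ∘ₗ s
      norm_map' := fun y => by
        rw [LinearMap.comp_apply, ← hfg, hs', Submodule.coe_norm] }
  refine ⟨L₀.extend, fun x => ?_⟩
  have hext := L₀.extend_apply ⟨f x, x, rfl⟩
  refine hext.trans ?_
  change g (s ⟨f x, x, rfl⟩) = g x
  rw [← sub_eq_zero, ← map_sub, ← norm_eq_zero, ← hfg, map_sub, hs', sub_self, norm_zero]

theorem Matrix.inner_toEuclideanLin_self {𝕜 m n : Type*} [RCLike 𝕜] [Fintype m] [Fintype n]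
    [DecidableEq m] [DecidableEq n] (A : Matrix m n 𝕜) (x : EuclideanSpace 𝕜 n) :
    inner 𝕜 (A.toEuclideanLin x) (A.toEuclideanLin x) =
      inner 𝕜 ((Aᴴ * A).toEuclideanLin x) x := by
  rw [← LinearMap.adjoint_inner_left, ← Matrix.toEuclideanLin_conjTranspose_eq_adjoint]
  simp [Matrix.toLpLin_apply, Matrix.mulVec_mulVec]

/-- If `X†X = Y†Y` for `N×M` complex matrices `X` and `Y`, then there is an
`N×N` unitary `U` with `U·X = Y`. -/
theorem exists_unitary_of_conjTranspose_mul_self_eq (N M : ℕ) (hN : 0 < N) (hM : 0 < M)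
    (X Y : Matrix (Fin N) (Fin M) ℂ) (h : Xᴴ * X = Yᴴ * Y) :
    ∃ U : Matrix (Fin N) (Fin N) ℂ, Uᴴ * U = 1 ∧ U * X = Y := by
  obtain ⟨L, hL⟩ := LinearMap.exists_linearIsometry_comp_eq X.toEuclideanLin Y.toEuclideanLin
    fun x => by
      rw [norm_eq_sqrt_re_inner (𝕜 := ℂ), norm_eq_sqrt_re_inner (𝕜 := ℂ),
        Matrix.inner_toEuclideanLin_self, Matrix.inner_toEuclideanLin_self, h]
  obtain ⟨U, hU⟩ := Matrix.toEuclideanLin.surjective L.toLinearMap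
  have hU' (x) : U.toEuclideanLin x = L x := LinearMap.congr_fun hU x
  refine ⟨U, ?_, ?_⟩
  · apply Matrix.toEuclideanLin.injective
    refine LinearMap.ext fun x => ext_inner_right ℂ fun y => ?_
    have hcomp : (Uᴴ * U).toEuclideanLin x = Uᴴ.toEuclideanLin (U.toEuclideanLin x) := by
      simp [Matrix.toLpLin_apply, Matrix.mulVec_mulVec]
    rw [hcomp, Matrix.toEuclideanLin_conjTranspose_eq_adjoint, LinearMap.adjoint_inner_left,
      hU', hU', L.inner_map_map]
    simp
  · apply Matrix.toEuclideanLin.injective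
    refine LinearMap.ext fun x => ?_
    rw [← hL, ← hU']
    simp [Matrix.toLpLin_apply, Matrix.mulVec_mulVec]
end
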